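/- Let K₀ = max{1, 2(9+ε)/r}. With probability tending to 1 as n → ∞, the random hypergraph 𝔾(n,p₂,p₃) contains no vertex v whose propagation component C_v satisfies K₀·ln n ≤ |C_v| ≤ n−1; that is, w.h.p. there is no propagation connected component of size between K₀·ln n and n−1. -/

import Mathlib

open MeasureTheory Real Filter

/-- Bernoulli-type measure on `Bool` with success probability `p`. -/
noncomputable def bern (p : ℝ) : Measure Bool :=
  (ENNReal.ofReal p) • Measure.dirac true + (ENNReal.ofReal (1 - p)) • Measure.dirac false

instance bern_finite (p : ℝ) : IsFiniteMeasure (bern p) := by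
  constructor
  simp only [bern, Measure.coe_add, Measure.coe_smul, Pi.add_apply, Pi.smul_apply,
    smul_eq_mul]
  finiteness

/-- Index type of potential edges: subsets of size 2 or 3. -/
abbrev EdgeIdx (n : ℕ) := {e : Finset (Fin n) // e.card = 2 ∨ e.card = 3}

/-- The law of the random hypergraph `𝔾(n, p₂, p₃)` with `p₂ = (1-ε)/n` and
`p₃ = r/(n ln n)`: the product of Bernoulli measures over all 2- and 3-subsets. -/
noncomputable def hypMeasure (n : ℕ) (ε r : ℝ) : Measure (EdgeIdx n → Bool) :=
  Measure.pi fun e =>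
    bern (if e.1.card = 2 then (1 - ε) / n else r / (n * Real.log n))

/-- `e` is an edge of the configuration `ω`. -/
def IsEdge {n : ℕ} (ω : EdgeIdx n → Bool) (e : Finset (Fin n)) : Prop :=
  ∃ h : e.card = 2 ∨ e.card = 3, ω ⟨e, h⟩ = true

/-- The constant `I_{ε,r} = -(1/r)(ε - ε²/2 + (1-ε)ln(1-ε))`. -/
noncomputable def Ier (ε r : ℝ) : ℝ :=
  -(1 / r) * (ε - ε ^ 2 / 2 + (1 - ε) * Real.log (1 - ε))

/-- The constant `K₀ = max {1, 2(9+ε)/r}`. -/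
noncomputable def K0 (ε r : ℝ) : ℝ := max 1 (2 * (9 + ε) / r)

/-- `f 0, …, f (k-1)` is a propagation sequence from the vertex set `S`:
every `f l` is an edge and meets `S ∪ f 0 ∪ ⋯ ∪ f (l-1)` in all but exactly
one vertex. -/
def IsPropSeqFrom {n : ℕ} (ω : EdgeIdx n → Bool) (S : Finset (Fin n))
    (k : ℕ) (f : ℕ → Finset (Fin n)) : Prop :=
  (∀ i < k, IsEdge ω (f i)) ∧
  ∀ l < k, (f l ∩ (S ∪ (Finset.range l).biUnion f)).card = (f l).card - 1

/-- The propagation component of the vertex set `S`: the union of `S` with all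
edges occurring in propagation sequences from `S`. -/
def propComponent {n : ℕ} (ω : EdgeIdx n → Bool) (S : Finset (Fin n)) : Set (Fin n) :=
  ↑S ∪ {x | ∃ k f, IsPropSeqFrom ω S k f ∧ ∃ i < k, x ∈ f i}

/-- The edge probability of `𝔾(n, p₂, p₃)` as a function of the size of the edge. -/
noncomputable def edgeProb (n : ℕ) (ε r : ℝ) (j : ℕ) : ℝ :=
  if j = 2 then (1 - ε) / n else r / (n * Real.log n)

/-- The probability of prescribing the presence of the edges in `A` and the absence of those
in `B`. -/
lemma hypMeasure_cylinder_le {n : ℕ} {ε r : ℝ}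
    (hq : ∀ j, 0 ≤ edgeProb n ε r j ∧ edgeProb n ε r j ≤ 1)
    (A B : Finset (Finset (Fin n))) (hA : ∀ e ∈ A, e.card = 2 ∨ e.card = 3)
    (hB : ∀ e ∈ B, e.card = 2 ∨ e.card = 3) (hAB : Disjoint A B) :
    hypMeasure n ε r {ω | (∀ e ∈ A, IsEdge ω e) ∧ ∀ e ∈ B, ¬ IsEdge ω e} ≤
      ENNReal.ofReal ((∏ e ∈ A, edgeProb n ε r e.card) *
        ∏ e ∈ B, (1 - edgeProb n ε r e.card)) := by
  classical
  have hsub : {ω : EdgeIdx n → Bool | (∀ e ∈ A, IsEdge ω e) ∧ ∀ e ∈ B, ¬ IsEdge ω e} ⊆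
      Set.pi Set.univ (fun e : EdgeIdx n =>
        if e.1 ∈ A then {true} else if e.1 ∈ B then {false} else Set.univ) := by
    rintro ω ⟨h1, h2⟩ e -
    by_cases ha : e.1 ∈ A
    · obtain ⟨_, h⟩ := h1 _ ha
      simpa [ha] using h
    · by_cases hb : e.1 ∈ B
      · have h := h2 _ hb
        simp only [ha, hb, if_true, if_false, Set.mem_singleton_iff]
        by_contra hne
        exact h ⟨e.2, by simpa using hne⟩
      · simp [ha, hb]
  refine (measure_mono hsub).trans ?_
  have hprod : (∏ e ∈ A, edgeProb n ε r e.card) * ∏ e ∈ B, (1 - edgeProb n ε r e.card) =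
      ∏ e : EdgeIdx n, (if e ∈ A.subtype (fun e : Finset (Fin n) => e.card = 2 ∨ e.card = 3) then
        edgeProb n ε r e.1.card else 1) *
        (if e ∈ B.subtype (fun e : Finset (Fin n) => e.card = 2 ∨ e.card = 3) then
        1 - edgeProb n ε r e.1.card else 1) := by
    rw [Finset.prod_mul_distrib, Finset.prod_ite_mem, Finset.prod_ite_mem, Finset.univ_inter,
      Finset.univ_inter, Finset.prod_subtype_of_mem (fun e => edgeProb n ε r e.card) hA,
      Finset.prod_subtype_of_mem (fun e => 1 - edgeProb n ε r e.card) hB]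
  rw [hprod, ENNReal.ofReal_prod_of_nonneg]
  · rw [hypMeasure, Measure.pi_pi]
    refine Finset.prod_le_prod' fun e _ => ?_
    have hqe := hq e.1.card
    change bern (edgeProb n ε r e.1.card) _ ≤ _
    by_cases ha : e.1 ∈ A
    · have hb : e.1 ∉ B := fun hb => Finset.disjoint_left.1 hAB ha hb
      simp [ha, hb, bern]
    · by_cases hb : e.1 ∈ B
      · simp [ha, hb, bern]
      · simp [ha, hb, bern]
        rw [← ENNReal.ofReal_add hqe.1 (by linarith)]
        simp
  · intro e _
    have hqe := hq e.1.card
    have : 0 ≤ 1 - edgeProb n ε r e.1.card := by linarith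
    split_ifs <;> simp [hqe.1, this, mul_nonneg]

/-- The finite sets obtained from the propagation process started at `v`. -/
inductive Reach {n : ℕ} (ω : EdgeIdx n → Bool) (v : Fin n) : Finset (Fin n) → Prop
  | base : Reach ω v {v}
  | step {T R : Finset (Fin n)} {w : Fin n} : Reach ω v T → R ⊆ T → w ∉ T →
      IsEdge ω (insert w R) → Reach ω v (insert w T)

lemma Reach.exists_isPropSeqFrom {n : ℕ} {ω : EdgeIdx n → Bool} {v : Fin n}
    {T : Finset (Fin n)} (h : Reach ω v T) :
    ∃ k f, IsPropSeqFrom ω {v} k f ∧ {v} ∪ (Finset.range k).biUnion f = T := by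
  induction h with
  | base => exact ⟨0, fun _ => ∅, ⟨by simp, by simp⟩, by simp⟩
  | @step T R w _ hR hw he ih =>
    obtain ⟨k, f, ⟨h1, h2⟩, h3⟩ := ih
    have hlt : ∀ i < k, Function.update f k (insert w R) i = f i := fun i hi =>
      Function.update_of_ne hi.ne _ _
    have hU : ∀ l ≤ k, (Finset.range l).biUnion (Function.update f k (insert w R)) =
        (Finset.range l).biUnion f := fun l hl =>
      Finset.biUnion_congr rfl fun i hi => hlt i ((Finset.mem_range.1 hi).trans_le hl)
    have hwR : w ∉ R := fun h => hw (hR h)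
    refine ⟨k + 1, Function.update f k (insert w R), ⟨fun i hi => ?_, fun l hl => ?_⟩, ?_⟩
    · rcases Nat.lt_succ_iff_lt_or_eq.1 hi with hi | rfl
      · rw [hlt i hi]; exact h1 i hi
      · simpa using he
    · rw [hU l (Nat.lt_succ_iff.1 hl)]
      rcases Nat.lt_succ_iff_lt_or_eq.1 hl with hl | rfl
      · rw [hlt l hl]; exact h2 l hl
      · rw [h3, Function.update_self, Finset.insert_inter_of_notMem hw,
          Finset.inter_eq_left.2 hR, Finset.card_insert_of_notMem hwR]
        rfl
    · rw [Finset.range_add_one, Finset.biUnion_insert, hU k le_rfl, Function.update_self,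
        Finset.union_left_comm, h3]
      ext x
      simp only [Finset.mem_union, Finset.mem_insert]
      constructor
      · rintro ((h | h) | h)
        exacts [Or.inl h, Or.inr (hR h), Or.inr h]
      · rintro (h | h)
        exacts [Or.inl (Or.inl h), Or.inr h]

lemma Reach.exists_parents {n : ℕ} {ω : EdgeIdx n → Bool} {v : Fin n}
    {T : Finset (Fin n)} (h : Reach ω v T) :
    v ∈ T ∧ ∃ g : Fin n → Finset (Fin n),
      (∀ u ∈ T, u ≠ v → u ∉ g u ∧ g u ⊆ T ∧ IsEdge ω (insert u (g u))) ∧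
      ∀ u ∈ T, u ≠ v → ∀ u' ∈ T, u' ≠ v → insert u (g u) = insert u' (g u') → u = u' := by
  induction h with
  | base => exact ⟨by simp, fun _ => ∅, by simp, by simp⟩
  | @step T R w _ hR hw he ih =>
    obtain ⟨hv, g, h1, h2⟩ := ih
    have hg : ∀ u ∈ T, Function.update g w R u = g u := fun u hu =>
      Function.update_of_ne (fun h : u = w => hw (h ▸ hu)) _ _
    have hnot : ∀ u ∈ T, u ≠ v → w ∉ insert u (g u) := fun u hu huv hmem => by
      rcases Finset.mem_insert.1 hmem with h | h
      · exact hw (h ▸ hu)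
      · exact hw ((h1 u hu huv).2.1 h)
    refine ⟨Finset.mem_insert_of_mem hv, Function.update g w R, fun u hu huv => ?_,
      fun u hu huv u' hu' huv' heq => ?_⟩
    · rcases Finset.mem_insert.1 hu with rfl | hu
      · rw [Function.update_self]
        exact ⟨fun h => hw (hR h), hR.trans (Finset.subset_insert _ _), he⟩
      · rw [hg u hu]
        obtain ⟨a, b, c⟩ := h1 u hu huv
        exact ⟨a, b.trans (Finset.subset_insert _ _), c⟩
    · rcases Finset.mem_insert.1 hu with rfl | huT <;>
      rcases Finset.mem_insert.1 hu' with rfl | huT'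
      · rfl
      · rw [hg u' huT', Function.update_self] at heq
        exact absurd (heq ▸ Finset.mem_insert_self _ _) (hnot u' huT' huv')
      · rw [hg u huT, Function.update_self] at heq
        exact absurd (heq ▸ Finset.mem_insert_self _ _) (hnot u huT huv)
      · rw [hg u huT, hg u' huT'] at heq
        exact h2 u huT huv u' huT' huv' heq

/-- No edge leaves `S` in exactly one vertex. -/
def PropClosed {n : ℕ} (ω : EdgeIdx n → Bool) (S : Finset (Fin n)) : Prop :=
  ∀ R ⊆ S, ∀ w ∉ S, ¬ IsEdge ω (insert w R)

lemma exists_reach_eq_propComponent {n : ℕ} (ω : EdgeIdx n → Bool) (v : Fin n) :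
    ∃ S : Finset (Fin n), Reach ω v S ∧ PropClosed ω S ∧ propComponent ω {v} = ↑S := by
  classical
  obtain ⟨S, hS, hmax⟩ := Finset.exists_max_image
    (Finset.univ.filter fun T : Finset (Fin n) => Reach ω v T) Finset.card
    ⟨{v}, by simpa using Reach.base⟩
  replace hS : Reach ω v S := by simpa using hS
  have hcl : PropClosed ω S := fun R hR w hw he => by
    have := hmax (insert w S) (by simpa using hS.step hR hw he)
    rw [Finset.card_insert_of_notMem hw] at this
    omega
  refine ⟨S, hS, hcl, Set.Subset.antisymm ?_ ?_⟩
  · have hvS := hS.exists_parents.1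
    rintro x (hx | ⟨k, f, ⟨h1, h2⟩, i, hi, hx⟩)
    · have : x = v := by simpa using hx
      exact this ▸ hvS
    · have key : ∀ i, i < k → f i ⊆ S := by
        intro i
        induction i using Nat.strong_induction_on with
        | _ i ih =>
          intro hi
          have hU : {v} ∪ (Finset.range i).biUnion f ⊆ S :=
            Finset.union_subset (Finset.singleton_subset_iff.2 hvS)
              (Finset.biUnion_subset.2 fun j hj =>
                ih j (Finset.mem_range.1 hj) ((Finset.mem_range.1 hj).trans hi))
          set U := {v} ∪ (Finset.range i).biUnion f
          have hc : (f i ∩ U).card = (f i).card - 1 := h2 i hi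
          have hsd : (f i \ U).card = 1 := by
            have := Finset.card_sdiff_add_card_inter (f i) U
            obtain ⟨h, _⟩ := h1 i hi
            omega
          obtain ⟨w, hw⟩ := Finset.card_eq_one.1 hsd
          have hdec : f i = insert w (f i ∩ U) := by
            rw [Finset.insert_eq, ← hw, Finset.sdiff_union_inter]
          by_contra hn
          have hwS : w ∉ S := fun hwS => hn (by
            rw [hdec]
            exact Finset.insert_subset hwS (Finset.inter_subset_right.trans hU))
          refine hcl (f i ∩ U) (Finset.inter_subset_right.trans hU) w hwS ?_
          rw [← hdec]
          exact h1 i hi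
      exact key i hi hx
  · obtain ⟨k, f, hf, rfl⟩ := hS.exists_isPropSeqFrom
    intro x hx
    rcases Finset.mem_union.1 (Finset.mem_coe.1 hx) with hx | hx
    · exact Or.inl hx
    · obtain ⟨i, hi, hx⟩ := Finset.mem_biUnion.1 hx
      exact Or.inr ⟨k, f, hf, i, Finset.mem_range.1 hi, hx⟩

/-- The subsets of `S` with one or two elements. -/
def smallSubsets {n : ℕ} (S : Finset (Fin n)) : Finset (Finset (Fin n)) :=
  S.powersetCard 1 ∪ S.powersetCard 2

lemma mem_smallSubsets {n : ℕ} {S T : Finset (Fin n)} :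
    T ∈ smallSubsets S ↔ T ⊆ S ∧ (T.card = 1 ∨ T.card = 2) := by
  simp only [smallSubsets, Finset.mem_union, Finset.mem_powersetCard]
  tauto

lemma sum_smallSubsets {n : ℕ} (S : Finset (Fin n)) (q : ℕ → ℝ) :
    ∑ T ∈ smallSubsets S, q (T.card + 1) = S.card * q 2 + (S.card.choose 2) * q 3 := by
  rw [smallSubsets, Finset.sum_union]
  · rw [Finset.sum_congr rfl (g := fun _ => q 2),
      Finset.sum_congr (s₁ := S.powersetCard 2) rfl (g := fun _ => q 3)]
    · simp
    · intro T hT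
      rw [(Finset.mem_powersetCard.1 hT).2]
    · intro T hT
      rw [(Finset.mem_powersetCard.1 hT).2]
  · rw [Finset.disjoint_left]
    intro T h1 h2
    have := (Finset.mem_powersetCard.1 h1).2
    have := (Finset.mem_powersetCard.1 h2).2
    omega

/-- The potential edges with exactly one vertex outside `S`. -/
def outEdges {n : ℕ} (S : Finset (Fin n)) : Finset (Finset (Fin n)) :=
  (smallSubsets S ×ˢ Sᶜ).image fun p => insert p.2 p.1

lemma card_of_mem_outEdges {n : ℕ} {S e : Finset (Fin n)} (he : e ∈ outEdges S) :
    (e.card = 2 ∨ e.card = 3) ∧ ¬ e ⊆ S := by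
  simp only [outEdges, Finset.mem_image, Finset.mem_product, mem_smallSubsets,
    Finset.mem_compl, Prod.exists] at he
  obtain ⟨T, b, ⟨⟨hT, hc⟩, hb⟩, rfl⟩ := he
  rw [Finset.card_insert_of_notMem fun h => hb (hT h)]
  exact ⟨by omega, fun h => hb (h (Finset.mem_insert_self _ _))⟩

lemma PropClosed.not_isEdge {n : ℕ} {ω : EdgeIdx n → Bool} {S e : Finset (Fin n)}
    (h : PropClosed ω S) (he : e ∈ outEdges S) : ¬ IsEdge ω e := by
  simp only [outEdges, Finset.mem_image, Finset.mem_product, mem_smallSubsets,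
    Finset.mem_compl, Prod.exists] at he
  obtain ⟨T, b, ⟨⟨hT, hc⟩, hb⟩, rfl⟩ := he
  exact h T hT b hb

lemma prod_outEdges_le {n : ℕ} (S : Finset (Fin n)) {q : ℕ → ℝ} (hq : ∀ j, q j ≤ 1) :
    ∏ e ∈ outEdges S, (1 - q e.card) ≤
      Real.exp (-((n - S.card) * (S.card * q 2 + (S.card.choose 2) * q 3))) := by
  have hsum : ∑ e ∈ outEdges S, q e.card =
      (n - S.card) * (S.card * q 2 + (S.card.choose 2) * q 3) := by
    rw [outEdges, Finset.sum_image, Finset.sum_product]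
    · rw [← sum_smallSubsets, Finset.mul_sum]
      refine Finset.sum_congr rfl fun T hT => ?_
      rw [Finset.sum_congr rfl (g := fun _ => q (T.card + 1))]
      · have : S.card ≤ n := by simpa using S.card_le_univ
        simp [Finset.card_compl, Nat.cast_sub this]
      · intro b hb
        rw [Finset.card_insert_of_notMem fun h =>
          Finset.mem_compl.1 hb ((mem_smallSubsets.1 hT).1 h)]
    · rintro ⟨T, b⟩ h ⟨T', b'⟩ h' heq
      simp only [Finset.coe_product, Set.mem_prod, Finset.mem_coe, mem_smallSubsets,
        Finset.mem_compl] at h h' heq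
      obtain ⟨⟨hT, -⟩, hb⟩ := h
      obtain ⟨⟨hT', -⟩, hb'⟩ := h'
      have h1 : T = T' := by
        have := congrArg (· ∩ S) heq
        simpa [Finset.insert_inter_of_notMem, hb, hb', Finset.inter_eq_left.2 hT,
          Finset.inter_eq_left.2 hT'] using this
      subst h1
      have h2 : b ∈ insert b' T := heq ▸ Finset.mem_insert_self _ _
      rcases Finset.mem_insert.1 h2 with h2 | h2
      · rw [h2]
      · exact absurd (hT h2) hb
  calc ∏ e ∈ outEdges S, (1 - q e.card) ≤ ∏ e ∈ outEdges S, Real.exp (-q e.card) :=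
        Finset.prod_le_prod (fun e _ => sub_nonneg.2 (hq _)) fun e _ =>
          Real.one_sub_le_exp_neg _
    _ = _ := by rw [← Real.exp_sum, Finset.sum_neg_distrib, hsum]

lemma hypMeasure_propClosed_le {n : ℕ} {ε r : ℝ}
    (hq : ∀ j, 0 ≤ edgeProb n ε r j ∧ edgeProb n ε r j ≤ 1) (S : Finset (Fin n)) :
    hypMeasure n ε r {ω | PropClosed ω S} ≤
      ENNReal.ofReal (Real.exp (-((n - S.card) *
        (S.card * edgeProb n ε r 2 + (S.card.choose 2) * edgeProb n ε r 3)))) := by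
  have h := hypMeasure_cylinder_le hq ∅ (outEdges S) (by simp)
    (fun e he => (card_of_mem_outEdges he).1) (by simp)
  rw [Finset.prod_empty, one_mul] at h
  have hsub : {ω | PropClosed ω S} ⊆ {ω | (∀ e ∈ (∅ : Finset (Finset (Fin n))), IsEdge ω e) ∧
      ∀ e ∈ outEdges S, ¬ IsEdge ω e} :=
    fun ω hω => ⟨by simp, fun e he => PropClosed.not_isEdge hω he⟩
  exact ((measure_mono hsub).trans h).trans (ENNReal.ofReal_le_ofReal (prod_outEdges_le S fun j => (hq j).2))

lemma hypMeasure_reach_le {n : ℕ} {ε r : ℝ}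
    (hq : ∀ j, 0 ≤ edgeProb n ε r j ∧ edgeProb n ε r j ≤ 1) (S : Finset (Fin n))
    (v : Fin n) (hv : v ∈ S) :
    hypMeasure n ε r {ω | Reach ω v S ∧ PropClosed ω S} ≤
      ENNReal.ofReal (((S.card - 1 : ℕ) * edgeProb n ε r 2 +
          ((S.card - 1).choose 2) * edgeProb n ε r 3) ^ (S.card - 1) *
        Real.exp (-((n - S.card) *
        (S.card * edgeProb n ε r 2 + (S.card.choose 2) * edgeProb n ε r 3)))) := by
  classical
  set q := edgeProb n ε r
  set X := Real.exp (-((n - S.card) * (S.card * q 2 + (S.card.choose 2) * q 3))) with hX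
  let I := {u : Fin n // u ∈ S.erase v}
  let F : Finset (I → Finset (Fin n)) :=
    (Fintype.piFinset fun u : I => smallSubsets (S.erase u.1)).filter
      fun g => Function.Injective fun u : I => insert u.1 (g u)
  let A : (I → Finset (Fin n)) → Finset (Finset (Fin n)) := fun g =>
    Finset.univ.image fun u : I => insert u.1 (g u)
  have hcard : ∀ g ∈ F, ∀ u : I, u.1 ∉ g u ∧ (insert u.1 (g u)).card = (g u).card + 1 ∧
      ((g u).card = 1 ∨ (g u).card = 2) ∧ insert u.1 (g u) ⊆ S := by
    intro g hg u
    have h := mem_smallSubsets.1 (Fintype.mem_piFinset.1 (Finset.mem_filter.1 hg).1 u)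
    have hu : u.1 ∉ g u := fun hu => Finset.notMem_erase _ _ (h.1 hu)
    exact ⟨hu, Finset.card_insert_of_notMem hu, h.2,
      Finset.insert_subset (Finset.mem_of_mem_erase u.2)
        (h.1.trans (Finset.erase_subset _ _))⟩
  have hsub : {ω | Reach ω v S ∧ PropClosed ω S} ⊆
      ⋃ g ∈ F, {ω | (∀ e ∈ A g, IsEdge ω e) ∧ ∀ e ∈ outEdges S, ¬ IsEdge ω e} := by
    rintro ω ⟨hR, hC⟩
    obtain ⟨-, g, h1, h2⟩ := hR.exists_parents
    simp only [Set.mem_iUnion]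
    refine ⟨fun u => g u.1, ?_, ?_, fun e he => hC.not_isEdge he⟩
    · refine Finset.mem_filter.2 ⟨Fintype.mem_piFinset.2 fun u => ?_, fun u u' h => ?_⟩
      · obtain ⟨a, b, c, -⟩ := h1 u.1 (Finset.mem_of_mem_erase u.2) (Finset.ne_of_mem_erase u.2)
        rw [Finset.card_insert_of_notMem a] at c
        exact mem_smallSubsets.2 ⟨Finset.subset_erase.2 ⟨b, a⟩, by omega⟩
      · exact Subtype.ext (h2 _ (Finset.mem_of_mem_erase u.2) (Finset.ne_of_mem_erase u.2)
          _ (Finset.mem_of_mem_erase u'.2) (Finset.ne_of_mem_erase u'.2) h)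
    · intro e he
      obtain ⟨u, -, rfl⟩ := Finset.mem_image.1 he
      exact (h1 u.1 (Finset.mem_of_mem_erase u.2) (Finset.ne_of_mem_erase u.2)).2.2
  have hterm : ∀ g ∈ F,
      hypMeasure n ε r {ω | (∀ e ∈ A g, IsEdge ω e) ∧ ∀ e ∈ outEdges S, ¬ IsEdge ω e} ≤
        ENNReal.ofReal ((∏ u : I, q ((g u).card + 1)) * X) := by
    intro g hg
    refine (hypMeasure_cylinder_le hq (A g) (outEdges S) ?_
      (fun e he => (card_of_mem_outEdges he).1) ?_).trans (ENNReal.ofReal_le_ofReal ?_)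
    · intro e he
      obtain ⟨u, -, rfl⟩ := Finset.mem_image.1 he
      have := hcard g hg u
      omega
    · rw [Finset.disjoint_left]
      intro e he he'
      obtain ⟨u, -, rfl⟩ := Finset.mem_image.1 he
      exact (card_of_mem_outEdges he').2 (hcard g hg u).2.2.2
    · rw [Finset.prod_image (Finset.mem_filter.1 hg).2.injOn]
      refine mul_le_mul (le_of_eq (Finset.prod_congr rfl fun u _ => ?_))
        (prod_outEdges_le S fun j => (hq j).2)
        (Finset.prod_nonneg fun e _ => sub_nonneg.2 (hq _).2)
        (Finset.prod_nonneg fun u _ => (hq _).1)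
      rw [(hcard g hg u).2.1]
  calc hypMeasure n ε r {ω | Reach ω v S ∧ PropClosed ω S}
      ≤ ∑ g ∈ F, ENNReal.ofReal ((∏ u : I, q ((g u).card + 1)) * X) :=
        (measure_mono hsub).trans ((measure_biUnion_finset_le _ _).trans
          (Finset.sum_le_sum hterm))
    _ ≤ ∑ g ∈ Fintype.piFinset fun u : I => smallSubsets (S.erase u.1),
          ENNReal.ofReal ((∏ u : I, q ((g u).card + 1)) * X) :=
        Finset.sum_le_sum_of_subset (Finset.filter_subset _ _)
    _ = ENNReal.ofReal ((∏ u : I, ∑ T ∈ smallSubsets (S.erase u.1), q (T.card + 1)) * X) := by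
        rw [← ENNReal.ofReal_sum_of_nonneg, Finset.prod_univ_sum, Finset.sum_mul]
        intro g _
        exact mul_nonneg (Finset.prod_nonneg fun u _ => (hq _).1) (Real.exp_pos _).le
    _ = _ := by
        congr 2
        rw [Finset.prod_congr rfl (g := fun _ => ((S.card - 1 : ℕ) * q 2 +
          ((S.card - 1).choose 2) * q 3))]
        · rw [Finset.prod_const, Finset.card_univ, Fintype.card_coe,
            Finset.card_erase_of_mem hv]
        · intro u _
          rw [sum_smallSubsets, Finset.card_erase_of_mem (Finset.mem_of_mem_erase u.2)]

lemma choose_mul_div_pow_le_exp (n k : ℕ) (hn : 0 < n) :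
    (n.choose k : ℝ) * ((k : ℝ) / n) ^ k ≤ Real.exp k := by
  have hn' : (0 : ℝ) < n := by exact_mod_cast hn
  calc (n.choose k : ℝ) * ((k : ℝ) / n) ^ k
      ≤ ((n : ℝ) ^ k / k.factorial) * ((k : ℝ) / n) ^ k := by
        gcongr
        exact Nat.choose_le_pow_div k n
    _ = (k : ℝ) ^ k / k.factorial := by
        rw [div_pow]
        field_simp
    _ ≤ Real.exp k := Real.pow_div_factorial_le_exp _ (Nat.cast_nonneg k) k

lemma mul_exp_le_exp_neg_three {y : ℝ} (hy : 10 ≤ y) :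
    Real.exp 1 * y * Real.exp (-(3 / 4 * (y - 1))) ≤ Real.exp (-3) := by
  have h8 : (8 : ℝ) ≤ Real.exp 2.1 := by
    rw [← Real.log_le_iff_le_exp (by norm_num), show (8 : ℝ) = 2 ^ 3 by norm_num, Real.log_pow]
    have := Real.log_two_lt_d9
    push_cast
    linarith
  have hy8 : y / 8 ≤ Real.exp (y / 8 - 1) := by
    have := Real.add_one_le_exp (y / 8 - 1)
    linarith
  have hy' : y ≤ Real.exp 2.1 * Real.exp (y / 8 - 1) := by
    calc y = 8 * (y / 8) := by ring
      _ ≤ _ := mul_le_mul h8 hy8 (by linarith) (Real.exp_pos _).le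
  calc Real.exp 1 * y * Real.exp (-(3 / 4 * (y - 1)))
      ≤ Real.exp 1 * (Real.exp 2.1 * Real.exp (y / 8 - 1)) *
        Real.exp (-(3 / 4 * (y - 1))) := by gcongr
    _ = Real.exp (1 + (2.1 + (y / 8 - 1)) + -(3 / 4 * (y - 1))) := by
        simp only [Real.exp_add]
    _ ≤ Real.exp (-3) := Real.exp_le_exp.2 (by linarith)

lemma choose_mul_reach_bound_le {n k : ℕ} {ε r L : ℝ} (hε0 : 0 < ε) (hε1 : ε < 1) (hr : 0 < r)
    (hL : Real.exp L = n) (hL1 : 1 ≤ L) (hrL : r ≤ 2 * L) (hkL : L ≤ k)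
    (hk : 2 * (9 + ε) / r * L ≤ k) (hkn : 4 * k ≤ n) :
    (n.choose k : ℝ) * (k * (((k - 1 : ℕ) * ((1 - ε) / n) +
      ((k - 1).choose 2) * (r / (n * L))) ^ (k - 1) *
      Real.exp (-((n - k) * (k * ((1 - ε) / n) + (k.choose 2) * (r / (n * L))))))) ≤
      1 / (n : ℝ) ^ 2 := by
  have hL0 : 0 < L := by linarith
  have hn : (0 : ℝ) < n := hL ▸ Real.exp_pos L
  have hk0 : (0 : ℝ) < k := by linarith
  have hk1 : 1 ≤ k := by exact_mod_cast hk0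
  have hkn' : 4 * (k : ℝ) ≤ n := by exact_mod_cast hkn
  set y : ℝ := 1 - ε + r * k / (2 * L) with hy
  have hy10 : 10 ≤ y := by
    have : 9 + ε ≤ r * k / (2 * L) := by
      rw [le_div_iff₀ (by linarith)]
      rw [div_mul_eq_mul_div, div_le_iff₀ hr] at hk
      linarith
    linarith
  have hQ : ((k - 1 : ℕ) : ℝ) * ((1 - ε) / n) + ((k - 1).choose 2) * (r / (n * L)) ≤
      k / n * y := by
    have h1 : ((k - 1 : ℕ) : ℝ) ≤ k := by exact_mod_cast Nat.sub_le k 1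
    have h2 : ((k - 1).choose 2 : ℝ) ≤ k ^ 2 / 2 := by
      rw [Nat.cast_choose_two]
      have := (Nat.cast_nonneg (k - 1) : (0 : ℝ) ≤ (k - 1 : ℕ))
      nlinarith
    calc ((k - 1 : ℕ) : ℝ) * ((1 - ε) / n) + ((k - 1).choose 2) * (r / (n * L))
        ≤ k * ((1 - ε) / n) + k ^ 2 / 2 * (r / (n * L)) := by
          have : 0 ≤ (1 - ε) / n := div_nonneg (by linarith) hn.le
          gcongr
      _ = k / n * y := by
          rw [hy]
          field_simp
  have hQ0 : 0 ≤ ((k - 1 : ℕ) : ℝ) * ((1 - ε) / n) + ((k - 1).choose 2) * (r / (n * L)) := by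
    have : 0 ≤ (1 - ε) / n := div_nonneg (by linarith) hn.le
    positivity
  have hX : 3 / 4 * (y - 1) * k ≤
      (n - k) * (k * ((1 - ε) / n) + (k.choose 2) * (r / (n * L))) := by
    have h1 : k * ((1 - ε) / n) + (k.choose 2) * (r / (n * L)) =
        k / n * (y - r / (2 * L)) := by
      rw [Nat.cast_choose_two, hy]
      field_simp
      ring
    have h2 : r / (2 * L) ≤ 1 := (div_le_one (by linarith)).2 hrL
    rw [h1]
    calc 3 / 4 * (y - 1) * k = (3 / 4 * n) * (k / n * (y - 1)) := by
          field_simp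
      _ ≤ (n - k) * (k / n * (y - r / (2 * L))) := by
          have : 0 ≤ y - 1 := by linarith
          gcongr
          · linarith
          · linarith
  have hpow : k * (((k - 1 : ℕ) : ℝ) * ((1 - ε) / n) +
      ((k - 1).choose 2) * (r / (n * L))) ^ (k - 1) ≤ n * (k / n * y) ^ k := by
    have h1 : (k : ℝ) ≤ n * (k / n * y) := by
      have : n * (k / n * y) = k * y := by field_simp
      rw [this]
      nlinarith
    calc k * (((k - 1 : ℕ) : ℝ) * ((1 - ε) / n) +
          ((k - 1).choose 2) * (r / (n * L))) ^ (k - 1)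
        ≤ n * (k / n * y) * (k / n * y) ^ (k - 1) := by gcongr
      _ = n * (k / n * y) ^ k := by
          rw [mul_assoc, ← pow_succ', Nat.sub_add_cancel hk1]
  calc _ = (n.choose k : ℝ) * ((k * (((k - 1 : ℕ) : ℝ) * ((1 - ε) / n) +
          ((k - 1).choose 2) * (r / (n * L))) ^ (k - 1)) *
          Real.exp (-((n - k) * (k * ((1 - ε) / n) + (k.choose 2) * (r / (n * L)))))) := by ring
    _ ≤ (n.choose k : ℝ) * ((n * (k / n * y) ^ k) * Real.exp (-(3 / 4 * (y - 1) * k))) := by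
        gcongr
    _ = n * ((n.choose k : ℝ) * (k / n) ^ k) * (y ^ k * Real.exp (-(3 / 4 * (y - 1) * k))) := by
        rw [mul_pow]
        ring
    _ ≤ n * Real.exp k * (y ^ k * Real.exp (-(3 / 4 * (y - 1) * k))) := by
        gcongr
        exact choose_mul_div_pow_le_exp n k (by exact_mod_cast hn)
    _ = n * (Real.exp 1 * y * Real.exp (-(3 / 4 * (y - 1)))) ^ k := by
        rw [mul_pow, mul_pow, ← Real.exp_nat_mul, ← Real.exp_nat_mul]
        ring_nf
    _ ≤ n * Real.exp (-3) ^ k := by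
        gcongr
        exact mul_exp_le_exp_neg_three hy10
    _ = n * Real.exp (k * (-3)) := by rw [← Real.exp_nat_mul]
    _ ≤ n * Real.exp (-(3 * L)) := by
        gcongr
        linarith
    _ = 1 / (n : ℝ) ^ 2 := by
        rw [← hL, ← Real.exp_nat_mul, ← Real.exp_add, one_div, ← Real.exp_neg]
        congr 1
        push_cast
        ring

lemma choose_mul_closed_bound_le {n k : ℕ} {ε r L : ℝ} (hε1 : ε < 1) (hr : 0 < r)
    (hL : Real.exp L = n) (hL1 : 1 ≤ L) (hn8 : 8 ≤ n) (hnL : L ^ 2 ≤ r / 192 * n)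
    (hkn : n ≤ 4 * k) (hk : k ≤ n - 1) :
    (n.choose k : ℝ) *
      Real.exp (-((n - k) * (k * ((1 - ε) / n) + (k.choose 2) * (r / (n * L))))) ≤
      1 / (n : ℝ) ^ 2 := by
  have hL0 : 0 < L := by linarith
  have hn : (0 : ℝ) < n := hL ▸ Real.exp_pos L
  obtain ⟨m, rfl⟩ : ∃ m, n = k + m := ⟨n - k, by omega⟩
  have hm1 : (1 : ℝ) ≤ m := by exact_mod_cast (by omega : 1 ≤ m)
  have hk2 : (2 : ℝ) ≤ k := by exact_mod_cast (by omega : 2 ≤ k)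
  have hkn' : ((k + m : ℕ) : ℝ) ≤ 4 * k := by exact_mod_cast hkn
  have hchoose : ((k + m).choose k : ℝ) ≤ Real.exp (m * L) := by
    rw [Real.exp_nat_mul, hL, Nat.choose_symm_add]
    exact_mod_cast Nat.choose_le_pow (k + m) m
  have hsub : ((k + m : ℕ) : ℝ) - k = m := by push_cast; ring
  generalize hN : ((k + m : ℕ) : ℝ) = N at *
  have hc : N ^ 2 / 64 ≤ (k.choose 2 : ℝ) := by
    rw [Nat.cast_choose_two]
    nlinarith
  have hX : 3 * L ≤ k * ((1 - ε) / N) + (k.choose 2) * (r / (N * L)) := by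
    have h0 : 0 ≤ k * ((1 - ε) / N) :=
      mul_nonneg (by linarith) (div_nonneg (by linarith) hn.le)
    have h1 : 3 * L ≤ N ^ 2 / 64 * (r / (N * L)) := by
      have : N ^ 2 / 64 * (r / (N * L)) = r / 192 * N * 3 / L := by
        field_simp
        norm_num
      rw [this, le_div_iff₀ hL0]
      nlinarith
    have h2 : N ^ 2 / 64 * (r / (N * L)) ≤ (k.choose 2) * (r / (N * L)) := by gcongr
    linarith
  rw [hsub]
  calc ((k + m).choose k : ℝ) *
        Real.exp (-(m * (k * ((1 - ε) / N) + (k.choose 2) * (r / (N * L)))))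
      ≤ Real.exp (m * L) * Real.exp (-(m * (3 * L))) := by gcongr
    _ = Real.exp (-(2 * (m * L))) := by
        rw [← Real.exp_add]
        ring_nf
    _ ≤ Real.exp (-(2 * L)) := by
        gcongr
        nlinarith
    _ = 1 / N ^ 2 := by
        rw [← hL, ← Real.exp_nat_mul, one_div, ← Real.exp_neg]
        norm_num

lemma hypMeasure_component_le {n : ℕ} {ε r : ℝ} (hε0 : 0 < ε) (hε1 : ε < 1) (hr : 0 < r)
    (hn8 : 8 ≤ n) (hL1 : 1 ≤ Real.log n) (hrL : r ≤ 2 * Real.log n)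
    (hnL : Real.log n ^ 2 ≤ r / 192 * n) (S : Finset (Fin n)) :
    hypMeasure n ε r {ω | ∃ v : Fin n, (Reach ω v S ∧ PropClosed ω S) ∧
      K0 ε r * Real.log n ≤ (S.card : ℝ) ∧ S.card ≤ n - 1} ≤
      ENNReal.ofReal (1 / (n : ℝ) ^ 2 / n.choose S.card) := by
  have hn8' : (8 : ℝ) ≤ n := by exact_mod_cast hn8
  have hn0 : (0 : ℝ) < n := by linarith
  have hL : Real.exp (Real.log n) = n := Real.exp_log hn0
  have hq : ∀ j, 0 ≤ edgeProb n ε r j ∧ edgeProb n ε r j ≤ 1 := by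
    intro j
    rw [edgeProb]
    split_ifs
    · exact ⟨div_nonneg (by linarith) hn0.le, (div_le_one hn0).2 (by linarith)⟩
    · exact ⟨by positivity, (div_le_one (by positivity)).2 (by nlinarith)⟩
  have hq2 : edgeProb n ε r 2 = (1 - ε) / n := rfl
  have hq3 : edgeProb n ε r 3 = r / (n * Real.log n) := rfl
  have hch : (0 : ℝ) < n.choose S.card := by
    exact_mod_cast Nat.choose_pos (by simpa using S.card_le_univ)
  by_cases hS : K0 ε r * Real.log n ≤ (S.card : ℝ) ∧ S.card ≤ n - 1
  swap
  · simp [hS]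
  obtain ⟨hS1, hS2⟩ := hS
  have hKL : Real.log n ≤ S.card := by
    have : 1 ≤ K0 ε r := le_max_left _ _
    nlinarith
  have hKr : 2 * (9 + ε) / r * Real.log n ≤ S.card :=
    (mul_le_mul_of_nonneg_right (le_max_right _ _) (by linarith)).trans hS1
  rcases le_total (4 * S.card) n with h4 | h4
  · have hsub : {ω | ∃ v : Fin n, (Reach ω v S ∧ PropClosed ω S) ∧
        K0 ε r * Real.log n ≤ (S.card : ℝ) ∧ S.card ≤ n - 1} ⊆
        ⋃ v ∈ S, {ω | Reach ω v S ∧ PropClosed ω S} := by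
      rintro ω ⟨v, h, -⟩
      exact Set.mem_biUnion h.1.exists_parents.1 h
    refine (measure_mono hsub).trans ((measure_biUnion_finset_le _ _).trans
      ((Finset.sum_le_sum fun v hv => hypMeasure_reach_le hq S v hv).trans ?_))
    rw [Finset.sum_const, nsmul_eq_mul, ← ENNReal.ofReal_natCast,
      ← ENNReal.ofReal_mul (Nat.cast_nonneg _), hq2, hq3]
    refine ENNReal.ofReal_le_ofReal ((le_div_iff₀' hch).2 ?_)
    exact choose_mul_reach_bound_le hε0 hε1 hr hL hL1 hrL hKL hKr h4
  · have hsub : {ω | ∃ v : Fin n, (Reach ω v S ∧ PropClosed ω S) ∧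
        K0 ε r * Real.log n ≤ (S.card : ℝ) ∧ S.card ≤ n - 1} ⊆ {ω | PropClosed ω S} := by
      rintro ω ⟨v, h, -⟩
      exact h.2
    refine (measure_mono hsub).trans ((hypMeasure_propClosed_le hq S).trans ?_)
    rw [hq2, hq3]
    refine ENNReal.ofReal_le_ofReal ((le_div_iff₀' hch).2 ?_)
    exact choose_mul_closed_bound_le hε1 hr hL hL1 hn8 hnL h4 hS2

lemma hypMeasure_bad_le {n : ℕ} {ε r : ℝ} (hε0 : 0 < ε) (hε1 : ε < 1) (hr : 0 < r)
    (hn8 : 8 ≤ n) (hL1 : 1 ≤ Real.log n) (hrL : r ≤ 2 * Real.log n)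
    (hnL : Real.log n ^ 2 ≤ r / 192 * n) :
    hypMeasure n ε r {ω | ∃ v : Fin n,
      K0 ε r * Real.log n ≤ ((propComponent ω {v}).ncard : ℝ) ∧
      (propComponent ω {v}).ncard ≤ n - 1} ≤ ENNReal.ofReal (2 / n) := by
  have hn0 : (0 : ℝ) < n := by exact_mod_cast (by omega : 0 < n)
  have hsub : {ω | ∃ v : Fin n,
      K0 ε r * Real.log n ≤ ((propComponent ω {v}).ncard : ℝ) ∧
      (propComponent ω {v}).ncard ≤ n - 1} ⊆
      ⋃ S ∈ (Finset.univ : Finset (Fin n)).powerset, {ω | ∃ v : Fin n,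
        (Reach ω v S ∧ PropClosed ω S) ∧
        K0 ε r * Real.log n ≤ (S.card : ℝ) ∧ S.card ≤ n - 1} := by
    rintro ω ⟨v, h⟩
    obtain ⟨S, hR, hC, hS⟩ := exists_reach_eq_propComponent ω v
    rw [hS, Set.ncard_coe_finset] at h
    exact Set.mem_biUnion (by simp) ⟨v, ⟨hR, hC⟩, h⟩
  refine (measure_mono hsub).trans ((measure_biUnion_finset_le _ _).trans
    ((Finset.sum_le_sum fun S _ =>
      hypMeasure_component_le hε0 hε1 hr hn8 hL1 hrL hnL S).trans ?_))
  rw [← ENNReal.ofReal_sum_of_nonneg fun S _ => by positivity]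
  refine ENNReal.ofReal_le_ofReal ?_
  rw [Finset.sum_powerset_apply_card (fun k => 1 / (n : ℝ) ^ 2 / n.choose k),
    Finset.card_univ, Fintype.card_fin]
  calc ∑ k ∈ Finset.range (n + 1), n.choose k • (1 / (n : ℝ) ^ 2 / n.choose k)
      = ∑ k ∈ Finset.range (n + 1), 1 / (n : ℝ) ^ 2 := by
        refine Finset.sum_congr rfl fun k hk => ?_
        have : (n.choose k : ℝ) ≠ 0 := by
          exact_mod_cast (Nat.choose_pos (Nat.lt_succ_iff.1 (Finset.mem_range.1 hk))).ne'
        rw [nsmul_eq_mul, mul_div_cancel₀ _ this]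
    _ = (n + 1) / (n : ℝ) ^ 2 := by
        simp [div_eq_mul_inv]
    _ ≤ 2 / n := by
        rw [div_le_div_iff₀ (by positivity) hn0]
        have : (1 : ℝ) ≤ n := by exact_mod_cast (by omega : 1 ≤ n)
        nlinarith

/-- W.h.p. there is no propagation connected component of size between
`K₀ ln n` and `n - 1`. -/
theorem no_component_of_intermediate_size (ε r : ℝ) (hε0 : 0 < ε) (hε1 : ε < 1)
    (hr : 0 < r) :
    Tendsto
      (fun n : ℕ => hypMeasure n ε r
        {ω | ∃ v : Fin n,
          K0 ε r * Real.log n ≤ ((propComponent ω {v}).ncard : ℝ) ∧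
          (propComponent ω {v}).ncard ≤ n - 1})
      atTop (nhds 0) := by
  have hlog : Tendsto (fun n : ℕ => Real.log n) atTop atTop :=
    Real.tendsto_log_atTop.comp tendsto_natCast_atTop_atTop
  have hsq : ∀ᶠ n : ℕ in atTop, Real.log n ^ 2 ≤ r / 192 * n := by
    filter_upwards [tendsto_natCast_atTop_atTop.eventually
      ((isLittleO_pow_log_id_atTop (n := 2)).def (by positivity : 0 < r / 192))] with n hn
    simpa using hn
  refine tendsto_of_tendsto_of_tendsto_of_le_of_le' tendsto_const_nhds
    (h := fun n : ℕ => ENNReal.ofReal (2 / n)) ?_ (Eventually.of_forall fun _ => zero_le) ?_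
  · simpa using ENNReal.tendsto_ofReal (tendsto_const_div_atTop_nhds_zero_nat (2 : ℝ))
  · filter_upwards [eventually_ge_atTop 8, hlog.eventually_ge_atTop 1,
      hlog.eventually_ge_atTop (r / 2), hsq] with n h8 h1 h2 h3
    exact hypMeasure_bad_le hε0 hε1 hr h8 h1 (by linarith) h3
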